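/- arXiv:2408.08246 — 2 statements merged into one kernel-verified Lean document; each statement's English description precedes it below -/
import Mathlib

section
/- Let v ∈ ℍⁿ_c be a central point. Then v can be written as v = A + Bs with A, B ∈ ℝⁿ and s ∈ 𝕊 (i.e., vⱼ = Aⱼ + Bⱼ s for all j), and for any such expression, the conjugation orbit 𝕊_v = {(qv₁q⁻¹,…,qvₙq⁻¹) : q ∈ ℍ∖{0}} equals A + B𝕊 = {(A₁ + B₁t, …, Aₙ + Bₙt) : t ∈ 𝕊}. -/
open Quaternion

theorem Quaternion.exists_components (a b c d : ℝ) :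
    ∃ q : ℍ[ℝ], q.re = a ∧ q.imI = b ∧ q.imJ = c ∧ q.imK = d :=
  ⟨⟨a, b, c, d⟩, rfl, rfl, rfl, rfl⟩

/-- The imaginary units are the quaternions `s` with real part `0` and imaginary part of norm `1`. -/
theorem Quaternion.sq_eq_neg_one_iff (s : ℍ[ℝ]) :
    s ^ 2 = -1 ↔ s.re = 0 ∧ s.imI ^ 2 + s.imJ ^ 2 + s.imK ^ 2 = 1 := by
  rw [pow_two, Quaternion.ext_iff]
  simp only [Quaternion.re_mul, Quaternion.imI_mul, Quaternion.imJ_mul, Quaternion.imK_mul,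
    Quaternion.re_neg, Quaternion.imI_neg, Quaternion.imJ_neg, Quaternion.imK_neg,
    Quaternion.re_one, Quaternion.imI_one, Quaternion.imJ_one, Quaternion.imK_one]
  constructor
  · rintro ⟨h0, h1, h2, h3⟩
    have hre : s.re = 0 := by
      by_contra h
      have e1 : s.imI = 0 := mul_left_cancel₀ h (by linarith)
      have e2 : s.imJ = 0 := mul_left_cancel₀ h (by linarith)
      have e3 : s.imK = 0 := mul_left_cancel₀ h (by linarith)
      rw [e1, e2, e3] at h0
      nlinarith [sq_nonneg s.re]
    refine ⟨hre, ?_⟩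
    rw [hre] at h0
    linarith
  · rintro ⟨h, h'⟩
    rw [h]
    refine ⟨?_, ?_, ?_, ?_⟩ <;> linarith

/-- Any two imaginary units are conjugate. -/
theorem Quaternion.exists_mul_eq_mul_of_sq_eq_neg_one {s t : ℍ[ℝ]} (hs : s ^ 2 = -1)
    (ht : t ^ 2 = -1) : ∃ q : ℍ[ℝ], q ≠ 0 ∧ q * s = t * q := by
  have hs2 : s * s = -1 := by rw [← pow_two, hs]
  have ht2 : t * t = -1 := by rw [← pow_two, ht]
  by_cases h : 1 - t * s = 0
  · have hts : t = -s := by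
      have e : t * (1 - t * s) = t + s := by
        rw [mul_sub, mul_one, ← mul_assoc, ht2]; simp
      rw [h, mul_zero] at e
      exact eq_neg_of_add_eq_zero_left e.symm
    obtain ⟨h0, -⟩ := (Quaternion.sq_eq_neg_one_iff s).1 hs
    by_cases hij : s.imI = 0 ∧ s.imJ = 0
    · obtain ⟨q, q0, q1, q2, q3⟩ := Quaternion.exists_components 0 1 0 0
      refine ⟨q, fun e => ?_, ?_⟩
      · simp [e] at q1
      · rw [hts]
        ext <;> simp [h0, hij.1, hij.2, q0, q1, q2, q3]
    · obtain ⟨q, q0, q1, q2, q3⟩ := Quaternion.exists_components 0 (-s.imJ) s.imI 0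
      refine ⟨q, fun e => hij ?_, ?_⟩
      · rw [e] at q1 q2
        simp only [Quaternion.imI_zero, Quaternion.imJ_zero] at q1 q2
        exact ⟨q2.symm, neg_eq_zero.1 q1.symm⟩
      · rw [hts]
        ext <;> simp [h0, q0, q1, q2, q3] <;> ring
  · refine ⟨1 - t * s, h, ?_⟩
    rw [sub_mul, mul_sub, mul_assoc, hs2, ← mul_assoc, ht2]
    simp [add_comm]

/-- Pairwise commuting quaternions lie in a common complex slice. -/
theorem Quaternion.exists_slice_of_commute {ι : Type*} (v : ι → ℍ[ℝ])
    (hv : ∀ i j, v i * v j = v j * v i) :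
    ∃ (A B : ι → ℝ) (s : ℍ[ℝ]), s ^ 2 = -1 ∧
      ∀ j, v j = (A j : ℍ[ℝ]) + (B j : ℍ[ℝ]) * s := by
  by_cases hreal : ∀ j, v j = ((v j).re : ℍ[ℝ])
  · obtain ⟨s, s0, s1, s2, s3⟩ := Quaternion.exists_components 0 1 0 0
    refine ⟨fun j => (v j).re, 0, s, ?_, fun j => ?_⟩
    · simp [Quaternion.sq_eq_neg_one_iff, s0, s1, s2, s3]
    · simpa using hreal j
  · push Not at hreal
    obtain ⟨k, hk⟩ := hreal
    set N := (v k).imI ^ 2 + (v k).imJ ^ 2 + (v k).imK ^ 2 with hN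
    have hNpos : 0 < N := by
      refine lt_of_le_of_ne (by positivity) fun h => hk ?_
      have e1 : (v k).imI = 0 := by
        nlinarith [sq_nonneg (v k).imI, sq_nonneg (v k).imJ, sq_nonneg (v k).imK]
      have e2 : (v k).imJ = 0 := by
        nlinarith [sq_nonneg (v k).imI, sq_nonneg (v k).imJ, sq_nonneg (v k).imK]
      have e3 : (v k).imK = 0 := by
        nlinarith [sq_nonneg (v k).imI, sq_nonneg (v k).imJ, sq_nonneg (v k).imK]
      ext <;> simp [e1, e2, e3]
    obtain ⟨r, hrN⟩ : ∃ r : ℝ, r ^ 2 = N := ⟨√N, Real.sq_sqrt hNpos.le⟩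
    obtain ⟨s, s0, s1, s2, s3⟩ :=
      Quaternion.exists_components 0 ((v k).imI / r) ((v k).imJ / r) ((v k).imK / r)
    refine ⟨fun j => (v j).re,
      fun j => ((v j).imI * (v k).imI + (v j).imJ * (v k).imJ + (v j).imK * (v k).imK) / r,
      s, ?_, fun j => ?_⟩
    · rw [Quaternion.sq_eq_neg_one_iff]
      refine ⟨s0, ?_⟩
      simp only [s1, s2, s3, div_pow, ← add_div]
      rw [hrN, ← hN, div_self hNpos.ne']
    · have c := Quaternion.ext_iff.1 (hv j k)
      simp only [Quaternion.re_mul, Quaternion.imI_mul, Quaternion.imJ_mul,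
        Quaternion.imK_mul] at c
      obtain ⟨-, c1, c2, c3⟩ := c
      have key : ∀ x y d : ℝ, x * N = d * y → x = d / r * (y / r) := fun x y d h => by
        rw [div_mul_div_comm, ← pow_two, hrN, eq_div_iff hNpos.ne', h]
      rw [Quaternion.ext_iff]
      simp only [Quaternion.re_add, Quaternion.imI_add, Quaternion.imJ_add, Quaternion.imK_add,
        Quaternion.re_mul, Quaternion.imI_mul, Quaternion.imJ_mul, Quaternion.imK_mul,
        Quaternion.re_coe, Quaternion.imI_coe, Quaternion.imJ_coe, Quaternion.imK_coe,
        s0, s1, s2, s3, mul_zero, zero_mul, sub_zero, add_zero, zero_add]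
      refine ⟨trivial, key _ _ _ ?_, key _ _ _ ?_, key _ _ _ ?_⟩ <;> rw [hN]
      · linear_combination (v k).imJ * c3 / 2 - (v k).imK * c2 / 2
      · linear_combination (v k).imK * c1 / 2 - (v k).imI * c3 / 2
      · linear_combination (v k).imI * c2 / 2 - (v k).imJ * c1 / 2

theorem Quaternion.conj_coe_add_coe_mul {q : ℍ[ℝ]} (hq : q ≠ 0) (a b : ℝ) (s : ℍ[ℝ]) :
    q * ((a : ℍ[ℝ]) + (b : ℍ[ℝ]) * s) * q⁻¹ = (a : ℍ[ℝ]) + (b : ℍ[ℝ]) * (q * s * q⁻¹) := by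
  rw [mul_add, add_mul, ← Quaternion.coe_commutes a q, mul_assoc (a : ℍ[ℝ]), mul_inv_cancel₀ hq,
    mul_one, ← mul_assoc q, ← Quaternion.coe_commutes b q]
  simp only [mul_assoc]

/-- A central point `v ∈ ℍⁿ_c` can be written as `v = A + Bs` with
`A, B ∈ ℝⁿ` and `s ∈ 𝕊`, and for any such expression the conjugation orbit
`𝕊_v = {(qv₁q⁻¹,…,qvₙq⁻¹) : q ∈ ℍ \ {0}}` equals
`A + B𝕊 = {(A₁ + B₁t,…,Aₙ + Bₙt) : t ∈ 𝕊}`. -/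
theorem central_point_decomposition_and_orbit
    (n : ℕ) (v : Fin n → ℍ[ℝ]) (hv : ∀ i j, v i * v j = v j * v i) :
    (∃ (A B : Fin n → ℝ) (s : ℍ[ℝ]), s ^ 2 = -1 ∧
        ∀ j, v j = (A j : ℍ[ℝ]) + (B j : ℍ[ℝ]) * s) ∧
    ∀ (A B : Fin n → ℝ) (s : ℍ[ℝ]), s ^ 2 = -1 →
      (∀ j, v j = (A j : ℍ[ℝ]) + (B j : ℍ[ℝ]) * s) →
      {w : Fin n → ℍ[ℝ] | ∃ q : ℍ[ℝ], q ≠ 0 ∧ ∀ j, w j = q * v j * q⁻¹}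
        = {w : Fin n → ℍ[ℝ] | ∃ t : ℍ[ℝ], t ^ 2 = -1 ∧
            ∀ j, w j = (A j : ℍ[ℝ]) + (B j : ℍ[ℝ]) * t} := by
  refine ⟨Quaternion.exists_slice_of_commute v hv, fun A B s hs hvs => Set.ext fun w => ?_⟩
  constructor
  · rintro ⟨q, hq, hw⟩
    refine ⟨q * s * q⁻¹, ?_, fun j => ?_⟩
    · have e : (q * s * q⁻¹) ^ 2 = q * s ^ 2 * q⁻¹ := by simp [pow_two, mul_assoc, hq]
      rw [e, hs, mul_neg_one, neg_mul, mul_inv_cancel₀ hq]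
    · rw [hw, hvs, Quaternion.conj_coe_add_coe_mul hq]
  · rintro ⟨t, ht, hw⟩
    obtain ⟨q, hq, hqs⟩ := Quaternion.exists_mul_eq_mul_of_sq_eq_neg_one hs ht
    refine ⟨q, hq, fun j => ?_⟩
    rw [hw, hvs, Quaternion.conj_coe_add_coe_mul hq, hqs, mul_inv_cancel_right₀ hq]
end

section
/- Let k be a field of characteristic not 2 in which −1 is not a square, and let E = k(α,β) be the rational function field in two algebraically independent variables α, β over k. Then the quadratic form q(x,y,z,w) = x² + y² − αz² − βw² in four variables over E is anisotropic: q(x,y,z,w) = 0 with x,y,z,w ∈ E implies x = y = z = w = 0. -/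
/-- If `-1` is not a square in a field, then `x² + y²` is anisotropic over it. -/
theorem sq_add_sq_ne_zero_of_neg_one_not_sq {k : Type*} [Field k]
    (hsq : ∀ c : k, c ^ 2 ≠ -1) {a b : k} (ha : a ≠ 0) : a ^ 2 + b ^ 2 ≠ 0 := by
  intro h
  apply hsq (b / a)
  field_simp
  linear_combination h

namespace MonomialOrder

variable {σ : Type*} (m : MonomialOrder σ) {k : Type*} [Field k]

open MvPolynomial

theorem sq_add_sq_ne_zero_and_degree_of_le (hsq : ∀ c : k, c ^ 2 ≠ -1) {f g : MvPolynomial σ k}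
    (hf : f ≠ 0) (hgf : m.degree g ≼[m] m.degree f) :
    f ^ 2 + g ^ 2 ≠ 0 ∧ m.degree (f ^ 2 + g ^ 2) = m.degree f + m.degree f := by
  have hc : (f ^ 2 + g ^ 2).coeff (m.degree f + m.degree f) ≠ 0 := by
    rw [coeff_add, sq f, sq g, m.coeff_mul_of_add_of_degree_le le_rfl le_rfl,
      m.coeff_mul_of_add_of_degree_le hgf hgf, ← sq, ← sq]
    exact sq_add_sq_ne_zero_of_neg_one_not_sq hsq (m.coeff_degree_ne_zero_iff.2 hf)
  refine ⟨fun h => hc (by rw [h, coeff_zero]), ?_⟩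
  apply m.toSyn.injective
  apply le_antisymm
  · refine m.degree_add_le.trans (sup_le ?_ ?_)
    · rw [sq]
      exact m.degree_mul_le
    · rw [sq]
      refine m.degree_mul_le.trans ?_
      rw [map_add, map_add]
      exact add_le_add hgf hgf
  · exact m.le_degree (mem_support_iff.2 hc)

theorem sq_add_sq_ne_zero_and_even_degree (hsq : ∀ c : k, c ^ 2 ≠ -1) {f g : MvPolynomial σ k}
    (h : f ≠ 0 ∨ g ≠ 0) :
    f ^ 2 + g ^ 2 ≠ 0 ∧ ∀ i, Even (m.degree (f ^ 2 + g ^ 2) i) := by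
  wlog hgf : g = 0 ∨ f ≠ 0 ∧ m.degree g ≼[m] m.degree f generalizing f g
  · rw [add_comm]
    apply this h.symm
    by_cases hf : f = 0
    · exact Or.inl hf
    · push Not at hgf
      exact Or.inr ⟨hgf.1, (hgf.2 hf).le⟩
  have hf : f ≠ 0 := by tauto
  have hle : m.degree g ≼[m] m.degree f := by
    rcases hgf with rfl | hgf
    · simp
    · exact hgf.2
  obtain ⟨h0, hd⟩ := m.sq_add_sq_ne_zero_and_degree_of_le hsq hf hle
  exact ⟨h0, fun i => ⟨m.degree f i, by rw [hd, Finsupp.add_apply]⟩⟩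

theorem degree_X_mul_sq (i : σ) {f : MvPolynomial σ k} (hf : f ≠ 0) :
    m.degree (X i * f ^ 2) = Finsupp.single i 1 + (m.degree f + m.degree f) := by
  rw [m.degree_mul (X_ne_zero i) (pow_ne_zero 2 hf), m.degree_X, sq, m.degree_mul hf hf]

theorem exists_odd_degree_X_mul_sq_add {i j : σ} (hij : i ≠ j) {f g : MvPolynomial σ k}
    (h : f ≠ 0 ∨ g ≠ 0) :
    ∃ l, Odd (m.degree (X i * f ^ 2 + X j * g ^ 2) l) := by
  have odd (l : σ) {p : MvPolynomial σ k} (hp : p ≠ 0) : Odd (m.degree (X l * p ^ 2) l) := by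
    rw [m.degree_X_mul_sq l hp]
    exact ⟨m.degree p l, by simp; ring⟩
  by_cases hf : f = 0
  · have hg : g ≠ 0 := by tauto
    exact ⟨j, by simpa [hf] using odd j hg⟩
  by_cases hg : g = 0
  · exact ⟨i, by simpa [hg] using odd i hf⟩
  have hne : m.degree (X i * f ^ 2) ≠ m.degree (X j * g ^ 2) := by
    intro e
    have h1 := odd i hf
    rw [e, m.degree_X_mul_sq j hg] at h1
    simp only [Finsupp.add_apply, Finsupp.single_eq_of_ne hij, zero_add] at h1
    exact Nat.not_even_iff_odd.2 h1 ⟨_, rfl⟩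
  rcases lt_or_gt_of_ne (m.toSyn.injective.ne hne) with hlt | hlt
  · exact ⟨j, by rw [m.degree_add_eq_right_of_lt hlt]; exact odd j hg⟩
  · exact ⟨i, by rw [m.degree_add_of_lt hlt]; exact odd i hf⟩

end MonomialOrder

/-- The form `x² + y² - Xᵢz² - Xⱼw²` is anisotropic over the polynomial ring. -/
theorem MvPolynomial.eq_zero_of_sq_add_sq_eq {σ k : Type*} [Field k] [LinearOrder σ]
    [WellFoundedGT σ] (hsq : ∀ c : k, c ^ 2 ≠ -1) {i j : σ} (hij : i ≠ j)
    {x y z w : MvPolynomial σ k} (h : x ^ 2 + y ^ 2 = X i * z ^ 2 + X j * w ^ 2) :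
    x = 0 ∧ y = 0 ∧ z = 0 ∧ w = 0 := by
  let m : MonomialOrder σ := MonomialOrder.lex
  by_cases hzw : z ≠ 0 ∨ w ≠ 0
  · obtain ⟨l, hl⟩ := m.exists_odd_degree_X_mul_sq_add hij hzw
    rw [← h] at hl
    by_cases hxy : x ≠ 0 ∨ y ≠ 0
    · exact absurd ((m.sq_add_sq_ne_zero_and_even_degree hsq hxy).2 l) (Nat.not_even_iff_odd.2 hl)
    · push Not at hxy
      simp [hxy.1, hxy.2] at hl
  · push Not at hzw
    by_cases hxy : x ≠ 0 ∨ y ≠ 0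
    · exact absurd (by simpa [hzw.1, hzw.2] using h)
        (m.sq_add_sq_ne_zero_and_even_degree hsq hxy).1
    · push Not at hxy
      exact ⟨hxy.1, hxy.2, hzw.1, hzw.2⟩

/-- Let `k` be a field of characteristic not `2` in which `−1` is
not a square, and let `E = k(α, β)` be the rational function field in two variables
over `k`.  Then the quadratic form `x² + y² − αz² − βw²` is anisotropic over `E`. -/
theorem quadratic_form_anisotropic
    (k : Type*) [Field k] (hchar : (2 : k) ≠ 0) (hsq : ∀ c : k, c ^ 2 ≠ -1)
    (x y z w : FractionRing (MvPolynomial (Fin 2) k))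
    (h : x ^ 2 + y ^ 2
        - algebraMap (MvPolynomial (Fin 2) k) (FractionRing (MvPolynomial (Fin 2) k))
            (MvPolynomial.X 0) * z ^ 2
        - algebraMap (MvPolynomial (Fin 2) k) (FractionRing (MvPolynomial (Fin 2) k))
            (MvPolynomial.X 1) * w ^ 2 = 0) :
    x = 0 ∧ y = 0 ∧ z = 0 ∧ w = 0 := by
  obtain ⟨b, hb⟩ := IsLocalization.exist_integer_multiples_of_finite
    (nonZeroDivisors (MvPolynomial (Fin 2) k)) ![x, y, z, w]
  obtain ⟨x', hx⟩ := hb 0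
  obtain ⟨y', hy⟩ := hb 1
  obtain ⟨z', hz⟩ := hb 2
  obtain ⟨w', hw⟩ := hb 3
  simp only [Algebra.smul_def, Matrix.cons_val] at hx hy hz hw
  have hinj := IsFractionRing.injective (MvPolynomial (Fin 2) k)
    (FractionRing (MvPolynomial (Fin 2) k))
  have hb0 := IsLocalization.to_map_ne_zero_of_mem_nonZeroDivisors
    (FractionRing (MvPolynomial (Fin 2) k)) le_rfl b.2
  have key : x' ^ 2 + y' ^ 2 = MvPolynomial.X 0 * z' ^ 2 + MvPolynomial.X 1 * w' ^ 2 := by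
    apply hinj
    simp only [map_add, map_mul, map_pow, hx, hy, hz, hw]
    linear_combination (algebraMap _ (FractionRing (MvPolynomial (Fin 2) k)) b.1) ^ 2 * h
  obtain ⟨rfl, rfl, rfl, rfl⟩ :=
    MvPolynomial.eq_zero_of_sq_add_sq_eq hsq (by decide : (0 : Fin 2) ≠ 1) key
  rw [map_zero, eq_comm, mul_eq_zero, or_iff_right hb0] at hx hy hz hw
  exact ⟨hx, hy, hz, hw⟩
end
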